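/- Let R be a Cohen–Macaulay local ring of dimension d ≥ 2 and 1 ≤ n ≤ d−1. Let M be a finitely generated R-module such that M_p has finite projective dimension over R_p for every prime p of height at most n. If Ext^i_R(M, R) = 0 for all 1 ≤ i ≤ 2d+1 and Ext^j_R(M, M) = 0 for all n ≤ j ≤ d−1, then M is free. -/

import Mathlib

open CategoryTheory TensorProduct IsLocalRing

noncomputable section

/-- The `n`-th Ext group of two `R`-modules. -/
abbrev extGroup (R : Type) [CommRing R] (n : ℕ) (M N : Type) [AddCommGroup M] [Module R M]
    [AddCommGroup N] [Module R N] : Type :=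
  ((Ext R (ModuleCat R) n).obj (Opposite.op (ModuleCat.of R M))).obj (ModuleCat.of R N)

/-- The `n`-th Tor group of two `R`-modules. -/
abbrev torGroup (R : Type) [CommRing R] (n : ℕ) (M N : Type) [AddCommGroup M] [Module R M]
    [AddCommGroup N] [Module R N] : Type :=
  ((Tor (ModuleCat R) n).obj (ModuleCat.of R M)).obj (ModuleCat.of R N)

/-- The depth of a module over a local ring, as the infimum of the degrees in which
`Ext(k, N)` is nonzero. -/
def moduleDepth (R : Type) [CommRing R] [IsLocalRing R] (N : Type) [AddCommGroup N]
    [Module R N] : ℕ∞ :=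
  sInf {n : ℕ∞ | ∃ k : ℕ, n = k ∧
    Nontrivial (extGroup R k (R ⧸ IsLocalRing.maximalIdeal R) N)}

/-- A module is maximal Cohen–Macaulay if `depth M_p = dim R_p` for all `p` in the support. -/
def IsMCM (R : Type) [CommRing R] (M : Type) [AddCommGroup M] [Module R M] : Prop :=
  ∀ p : PrimeSpectrum R, Nontrivial (LocalizedModule p.asIdeal.primeCompl M) →
    (moduleDepth (Localization.AtPrime p.asIdeal)
        (LocalizedModule p.asIdeal.primeCompl M) : WithBot ℕ∞) =
      ringKrullDim (Localization.AtPrime p.asIdeal)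

/-- A local ring is Cohen–Macaulay if its depth equals its Krull dimension. -/
def IsCMLocal (R : Type) [CommRing R] [IsLocalRing R] : Prop :=
  (moduleDepth R R : WithBot ℕ∞) = ringKrullDim R

/-- Injective dimension at most `n`, defined recursively via cosyzygies. -/
def hasInjDimLE (R : Type) [CommRing R] : ℕ → ∀ (M : Type) [AddCommGroup M] [Module R M], Prop
  | 0, M, _, _ => Module.Injective R M
  | (n+1), M, _, _ => ∃ (I : Type) (_ : AddCommGroup I) (_ : Module R I) (f : M →ₗ[R] I),
      Module.Injective R I ∧ Function.Injective f ∧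
        hasInjDimLE R n (I ⧸ LinearMap.range f)

/-- Projective dimension at most `n`, defined recursively via syzygies. -/
def hasPdLE (R : Type) [CommRing R] : ℕ → ∀ (M : Type) [AddCommGroup M] [Module R M], Prop
  | 0, M, _, _ => Module.Projective R M
  | (n+1), M, _, _ => ∃ (P : Type) (_ : AddCommGroup P) (_ : Module R P) (f : P →ₗ[R] M),
      Module.Projective R P ∧ Function.Surjective f ∧ hasPdLE R n (LinearMap.ker f)

/-- `ω` is a canonical module of the Cohen–Macaulay local ring `R`: it is finitely generated,
maximal Cohen–Macaulay, of finite injective dimension, and of type one. -/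
def IsCanonicalModule (R : Type) [CommRing R] [IsLocalRing R] (ω : Type) [AddCommGroup ω]
    [Module R ω] : Prop :=
  Module.Finite R ω ∧ IsMCM R ω ∧ (∃ n, hasInjDimLE R n ω) ∧
    ∃ d : ℕ, ringKrullDim R = d ∧
      Nonempty (extGroup R d (R ⧸ IsLocalRing.maximalIdeal R) ω ≃ₗ[R]
        (R ⧸ IsLocalRing.maximalIdeal R))

/-- `T` is an Auslander transpose of `M`: the cokernel of the `R`-dual of a minimal
free presentation of `M`. -/
def IsAuslanderTranspose (R : Type) [CommRing R] [IsLocalRing R] (M T : Type)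
    [AddCommGroup M] [Module R M] [AddCommGroup T] [Module R T] : Prop :=
  ∃ (m n : ℕ) (f : (Fin n → R) →ₗ[R] (Fin m → R)),
    LinearMap.range f ≤ (IsLocalRing.maximalIdeal R) • (⊤ : Submodule R (Fin m → R)) ∧
    LinearMap.ker f ≤ (IsLocalRing.maximalIdeal R) • (⊤ : Submodule R (Fin n → R)) ∧
    Nonempty (((Fin m → R) ⧸ LinearMap.range f) ≃ₗ[R] M) ∧
    Nonempty ((Module.Dual R (Fin n → R) ⧸ LinearMap.range f.dualMap) ≃ₗ[R] T)

end

/-- Vanishing of the `i`-th Ext group. -/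
def ExtZero (A : Type) [CommRing A] (i : ℕ) (M X : Type) [AddCommGroup M] [Module A M]
    [AddCommGroup X] [Module A X] : Prop :=
  Subsingleton (Abelian.Ext (ModuleCat.of A M) (ModuleCat.of A X) i)

namespace ExtZero

variable {A : Type} [CommRing A] {M N X Y Z : Type} [AddCommGroup M] [Module A M]
  [AddCommGroup N] [Module A N] [AddCommGroup X] [Module A X] [AddCommGroup Y] [Module A Y]
  [AddCommGroup Z] [Module A Z]

lemma eq_zero {i : ℕ} (h : ExtZero A i M X)
    (x : Abelian.Ext (ModuleCat.of A M) (ModuleCat.of A X) i) : x = 0 :=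
  @Subsingleton.elim _ h _ _

lemma of_forall {i : ℕ}
    (h : ∀ x : Abelian.Ext (ModuleCat.of A M) (ModuleCat.of A X) i, x = 0) : ExtZero A i M X :=
  ⟨fun x y => (h x).trans (h y).symm⟩

/-- The short complex attached to an exact pair of linear maps. -/
noncomputable abbrev shortComplex (f : X →ₗ[A] Y) (g : Y →ₗ[A] Z) (h : Function.Exact f g) :
    ShortComplex (ModuleCat.{0} A) :=
  ShortComplex.mk (ModuleCat.ofHom f) (ModuleCat.ofHom g)
    (by rw [← ModuleCat.ofHom_comp, h.linearMap_comp_eq_zero]; rfl)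

lemma shortExact {f : X →ₗ[A] Y} {g : Y →ₗ[A] Z} (hf : Function.Injective f)
    (h : Function.Exact f g) (hg : Function.Surjective g) : (shortComplex f g h).ShortExact where
  exact := by
    rw [ShortComplex.moduleCat_exact_iff]
    exact fun y hy => (h y).mp hy
  mono_f := (ModuleCat.mono_iff_injective _).mpr hf
  epi_g := (ModuleCat.epi_iff_surjective _).mpr hg

section

variable {f : X →ₗ[A] Y} {g : Y →ₗ[A] Z} (hf : Function.Injective f)
    (h : Function.Exact f g) (hg : Function.Surjective g)
include hf h hg

lemma covariant_right {i : ℕ} (h₁ : ExtZero A i M Y) (h₂ : ExtZero A (i + 1) M X) :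
    ExtZero A i M Z := by
  refine of_forall fun x => ?_
  obtain ⟨y, hy⟩ := Abelian.Ext.covariant_sequence_exact₃ (ModuleCat.of A M)
    (shortExact hf h hg) x rfl (h₂.eq_zero _)
  rw [← hy, h₁.eq_zero y, Abelian.Ext.zero_comp]

lemma covariant_left {i : ℕ} (h₁ : ExtZero A i M Z) (h₂ : ExtZero A (i + 1) M Y) :
    ExtZero A (i + 1) M X := by
  refine of_forall fun x => ?_
  obtain ⟨y, hy⟩ := Abelian.Ext.covariant_sequence_exact₁ (ModuleCat.of A M)
    (shortExact hf h hg) x (h₂.eq_zero _) rfl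
  rw [← hy, h₁.eq_zero y, Abelian.Ext.zero_comp]

lemma contravariant_left {i : ℕ} (h₁ : ExtZero A i Y M) (h₂ : ExtZero A (i + 1) Z M) :
    ExtZero A i X M := by
  refine of_forall fun x => ?_
  obtain ⟨y, hy⟩ := Abelian.Ext.contravariant_sequence_exact₁ (shortExact hf h hg)
    (ModuleCat.of A M) x (add_comm 1 i) (h₂.eq_zero _)
  rw [← hy, h₁.eq_zero y, Abelian.Ext.comp_zero]

lemma contravariant_right {i : ℕ} (h₁ : ExtZero A i X M) (h₂ : ExtZero A (i + 1) Y M) :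
    ExtZero A (i + 1) Z M := by
  refine of_forall fun x => ?_
  obtain ⟨y, hy⟩ := Abelian.Ext.contravariant_sequence_exact₃ (shortExact hf h hg)
    (ModuleCat.of A M) x (h₂.eq_zero _) (add_comm 1 i)
  rw [← hy, h₁.eq_zero y, Abelian.Ext.comp_zero]

/-- Lifting along a surjection whose kernel has no `Ext¹`. -/
lemma exists_lift (h₁ : ExtZero A 1 M X) (φ : M →ₗ[A] Z) : ∃ ψ : M →ₗ[A] Y, g ∘ₗ ψ = φ := by
  obtain ⟨y, hy⟩ := Abelian.Ext.covariant_sequence_exact₃ (ModuleCat.of A M)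
    (shortExact hf h hg) (Abelian.Ext.mk₀ (ModuleCat.ofHom φ)) (zero_add 1) (h₁.eq_zero _)
  obtain ⟨ψ, rfl⟩ := (Abelian.Ext.mk₀_bijective _ _).2 y
  rw [Abelian.Ext.mk₀_comp_mk₀] at hy
  have := (Abelian.Ext.mk₀_bijective _ _).1 hy
  refine ⟨ψ.hom, ?_⟩
  simpa using congrArg ModuleCat.Hom.hom this

/-- Extending along an injection whose cokernel has no `Ext¹`. -/
lemma exists_extend (h₁ : ExtZero A 1 Z M) (φ : X →ₗ[A] M) : ∃ ψ : Y →ₗ[A] M, ψ ∘ₗ f = φ := by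
  obtain ⟨y, hy⟩ := Abelian.Ext.contravariant_sequence_exact₁ (shortExact hf h hg)
    (ModuleCat.of A M) (Abelian.Ext.mk₀ (ModuleCat.ofHom φ)) (add_zero 1) (h₁.eq_zero _)
  obtain ⟨ψ, rfl⟩ := (Abelian.Ext.mk₀_bijective _ _).2 y
  rw [Abelian.Ext.mk₀_comp_mk₀] at hy
  have := (Abelian.Ext.mk₀_bijective _ _).1 hy
  refine ⟨ψ.hom, ?_⟩
  simpa using congrArg ModuleCat.Hom.hom this

/-- `Ext¹` vanishes if all maps from a syzygy extend to the projective cover. -/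
lemma one_of_extend (hY : ExtZero A 1 Y M)
    (hext : ∀ φ : X →ₗ[A] M, ∃ ψ : Y →ₗ[A] M, ψ ∘ₗ f = φ) : ExtZero A 1 Z M := by
  refine of_forall fun x => ?_
  obtain ⟨y, hy⟩ := Abelian.Ext.contravariant_sequence_exact₃ (shortExact hf h hg)
    (ModuleCat.of A M) x (hY.eq_zero _) (add_zero 1)
  obtain ⟨φ, rfl⟩ := (Abelian.Ext.mk₀_bijective _ _).2 y
  obtain ⟨ψ, hψ⟩ := hext φ.hom
  have : φ = (shortComplex f g h).f ≫ ModuleCat.ofHom ψ := by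
    ext x
    exact (LinearMap.congr_fun hψ x).symm
  rw [← hy, this, ← Abelian.Ext.mk₀_comp_mk₀, ← Abelian.Ext.comp_assoc_of_third_deg_zero,
    (shortExact hf h hg).extClass_comp, Abelian.Ext.zero_comp]

end

lemma of_projective [Module.Projective A M] (i : ℕ) (hi : i ≠ 0) : ExtZero A i M X := by
  obtain ⟨i, rfl⟩ := Nat.exists_eq_succ_of_ne_zero hi
  have : Projective (ModuleCat.of A M) := (IsProjective.iff_projective M).mp inferInstance
  exact of_forall fun x => Abelian.Ext.eq_zero_of_projective x

lemma zero_iff : ExtZero A 0 M X ↔ Subsingleton (M →ₗ[A] X) := by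
  constructor
  · intro h
    refine ⟨fun f g => ?_⟩
    have := (Abelian.Ext.mk₀_bijective (ModuleCat.of A M) (ModuleCat.of A X)).1
      (@Subsingleton.elim _ h (Abelian.Ext.mk₀ (ModuleCat.ofHom f))
        (Abelian.Ext.mk₀ (ModuleCat.ofHom g)))
    exact congrArg ModuleCat.Hom.hom this
  · intro h
    refine of_forall fun x => ?_
    obtain ⟨φ, rfl⟩ := (Abelian.Ext.mk₀_bijective _ _).2 x
    have : φ = 0 := by
      ext1
      exact Subsingleton.elim _ _
    rw [this, Abelian.Ext.mk₀_zero]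

/-- If multiplication by `a` on `M` factors through finite free modules then it kills `Ext`. -/
lemma smul_eq_zero {i : ℕ} (hi : i ≠ 0) {a : A} {k : ℕ} (u : Fin k → M →ₗ[A] A) (m : Fin k → M)
    (hu : ∀ n, a • n = ∑ j, u j n • m j)
    (x : Abelian.Ext (ModuleCat.of A M) (ModuleCat.of A X) i) : a • x = 0 := by
  have key : a • (𝟙 (ModuleCat.of A M)) =
      ∑ j, ModuleCat.ofHom (u j) ≫ ModuleCat.ofHom (LinearMap.toSpanSingleton A M (m j)) := by
    ext n
    simp [ModuleCat.hom_sum, hu]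
  have h2 : a • x = (Abelian.Ext.mk₀ (a • (𝟙 (ModuleCat.of A M)))).comp x (zero_add i) := by
    rw [Abelian.Ext.mk₀_smul, Abelian.Ext.smul_comp, Abelian.Ext.mk₀_id_comp]
  rw [h2, key, Abelian.Ext.mk₀_sum, Abelian.Ext.sum_comp]
  refine Finset.sum_eq_zero fun j _ => ?_
  rw [← Abelian.Ext.mk₀_comp_mk₀, Abelian.Ext.comp_assoc_of_second_deg_zero,
    (of_projective (M := A) (X := X) i hi).eq_zero ((Abelian.Ext.mk₀ _).comp x _),
    Abelian.Ext.comp_zero]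

lemma of_smul_bijective {i : ℕ} (hi : i ≠ 0) {a : A} {k : ℕ} (u : Fin k → M →ₗ[A] A)
    (m : Fin k → M) (hu : ∀ n, a • n = ∑ j, u j n • m j)
    (ha : Function.Bijective fun x : X => a • x) : ExtZero A i M X := by
  refine of_forall fun x => ?_
  let e : X ≃ₗ[A] X := LinearEquiv.ofBijective (LinearMap.lsmul A X a) ha
  have h1 : x =
      a • (x.comp (Abelian.Ext.mk₀ (ModuleCat.ofHom e.symm.toLinearMap)) (add_zero i)) := by
    rw [← Abelian.Ext.comp_smul, ← Abelian.Ext.mk₀_smul]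
    have : a • ModuleCat.ofHom e.symm.toLinearMap = 𝟙 (ModuleCat.of A X) := by
      ext y
      exact e.apply_symm_apply y
    rw [this, Abelian.Ext.comp_mk₀_id]
  rw [h1, smul_eq_zero hi u m hu]

lemma congr_right {i : ℕ} (e : X ≃ₗ[A] Y) (h : ExtZero A i M X) : ExtZero A i M Y := by
  refine of_forall fun x => ?_
  have : x = (x.comp (Abelian.Ext.mk₀ (ModuleCat.ofHom e.symm.toLinearMap)) (add_zero i)).comp
      (Abelian.Ext.mk₀ (ModuleCat.ofHom e.toLinearMap)) (add_zero i) := by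
    rw [Abelian.Ext.comp_assoc_of_third_deg_zero, Abelian.Ext.mk₀_comp_mk₀]
    have : ModuleCat.ofHom e.symm.toLinearMap ≫ ModuleCat.ofHom e.toLinearMap = 𝟙 _ := by
      ext y
      exact e.apply_symm_apply y
    rw [this, Abelian.Ext.comp_mk₀_id]
  rw [this, h.eq_zero (x.comp _ _), Abelian.Ext.zero_comp]

lemma of_free [Module.Free A Y] [Module.Finite A Y] {i : ℕ} (h : ExtZero A i M A) :
    ExtZero A i M Y := by
  classical
  refine of_forall fun x => ?_
  let b := Module.Free.chooseBasis A Y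
  have key : 𝟙 (ModuleCat.of A Y) = ∑ j, ModuleCat.ofHom (b.coord j) ≫
      ModuleCat.ofHom (LinearMap.toSpanSingleton A Y (b j)) := by
    ext n
    simp [ModuleCat.hom_sum, b.sum_repr]
  rw [← Abelian.Ext.comp_mk₀_id x, key, Abelian.Ext.mk₀_sum, Abelian.Ext.comp_sum]
  refine Finset.sum_eq_zero fun j _ => ?_
  rw [← Abelian.Ext.mk₀_comp_mk₀, ← Abelian.Ext.comp_assoc_of_third_deg_zero,
    h.eq_zero (x.comp _ _), Abelian.Ext.zero_comp]

end ExtZero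

lemma ExtZero.of_extGroup {A : Type} [CommRing A] {M X : Type} [AddCommGroup M] [Module A M]
    [AddCommGroup X] [Module A X] {i : ℕ} (h : Subsingleton (extGroup A i M X)) :
    ExtZero A i M X := by
  let P := projectiveResolution (ModuleCat.of A M)
  have hex : (P.complex.linearYonedaObj A (ModuleCat.of A X)).ExactAt i := by
    rw [HomologicalComplex.exactAt_iff_isZero_homology]
    refine (ModuleCat.isZero_of_subsingleton _).of_iso
      (P.isoExt i (ModuleCat.of A X) (R := A)).symm
  refine ExtZero.of_forall fun x => ?_
  obtain ⟨f, hf, rfl⟩ := P.extMk_surjective x (i + 1) rfl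
  rcases i with _ | p
  · rw [HomologicalComplex.exactAt_iff' _ 0 0 1 (by simp) (by simp),
      ShortComplex.moduleCat_exact_iff] at hex
    obtain ⟨g, hg⟩ := hex f hf
    have hf0 : f = 0 := by
      rw [← hg]
      have : (P.complex.linearYonedaObj A (ModuleCat.of A X)).d 0 0 = 0 :=
        HomologicalComplex.shape _ _ _ (by simp)
      change (P.complex.linearYonedaObj A (ModuleCat.of A X)).d 0 0 g = 0
      rw [this]
      rfl
    subst hf0
    simp
  · rw [HomologicalComplex.exactAt_iff' _ p (p + 1) (p + 2) (by simp) (by simp),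
      ShortComplex.moduleCat_exact_iff] at hex
    obtain ⟨g, hg⟩ := hex f hf
    rw [P.extMk_eq_zero_iff _ _ _ _ p rfl]
    exact ⟨g, hg⟩

/-- The ideal of scalars whose multiplication map on `N` factors through a finite free module. -/
noncomputable def freeFactorIdeal (A : Type) [CommRing A] (N : Type) [AddCommGroup N]
    [Module A N] : Ideal A :=
  (LinearMap.range (dualTensorHom A N N)).comap
    (LinearMap.toSpanSingleton A (N →ₗ[A] N) LinearMap.id)

/-- Iterated syzygies, with no condition in degree zero. -/
def IsSyz (A : Type) [CommRing A] :
    ℕ → ∀ (L : Type) [AddCommGroup L] [Module A L], Prop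
  | 0, _, _, _ => True
  | j + 1, L, _, _ => ∃ (F C : Type) (_ : AddCommGroup F) (_ : AddCommGroup C)
      (_ : Module A F) (_ : Module A C) (f : L →ₗ[A] F) (g : F →ₗ[A] C),
      Module.Free A F ∧ Module.Finite A F ∧ Function.Injective f ∧ Function.Exact f g ∧
        Function.Surjective g ∧ IsSyz A j C

/-- The list is a regular sequence on `V`, modulo which there is a nonzero element killed
by `m`. -/
def RegSocle {A : Type} [CommRing A] (m : Ideal A) :
    List A → ∀ (V : Type) [AddCommGroup V] [Module A V], Prop
  | [], V, _, _ => ∃ σ : V, σ ≠ 0 ∧ ∀ z ∈ m, z • σ = 0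
  | y :: l, V, _, _ => IsSMulRegular V y ∧ RegSocle m l (QuotSMulTop y V)

/-- Tensoring with `V` preserves injectivity of inclusions of syzygies of `j`-th syzygies. -/
def SyzFlat (A : Type) [CommRing A] (j : ℕ) (V : Type) [AddCommGroup V] [Module A V] : Prop :=
  ∀ (N F L : Type) [AddCommGroup N] [AddCommGroup F] [AddCommGroup L] [Module A N] [Module A F]
    [Module A L] [Module.Free A F] [Module.Finite A F] (f : N →ₗ[A] F) (g : F →ₗ[A] L),
    Function.Injective f → Function.Exact f g → Function.Surjective g → IsSyz A j L →
    Function.Injective (f.rTensor V)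

/-- A short exact sequence `0 → V → V' → V'' → 0` in which `V'` behaves like the localization
of `V` away from `x`. -/
structure LocStep {A : Type} [CommRing A] (x : A) {V V' V'' : Type} [AddCommGroup V]
    [AddCommGroup V'] [AddCommGroup V''] [Module A V] [Module A V'] [Module A V'']
    (ι : V →ₗ[A] V') (π : V' →ₗ[A] V'') : Prop where
  inj : Function.Injective ι
  exact : Function.Exact ι π
  surj : Function.Surjective π
  bij : Function.Bijective fun v : V' => x • v
  clear : ∀ v : V', ∃ (k : ℕ) (w : V), x ^ k • v = ι w

section tensorSteps

variable {A : Type} [CommRing A]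

section FreeFactor

variable {N : Type} [AddCommGroup N] [Module A N]

lemma mem_freeFactorIdeal_iff {a : A} : a ∈ freeFactorIdeal A N ↔
    ∃ (k : ℕ) (u : Fin k → N →ₗ[A] A) (m : Fin k → N), ∀ n, a • n = ∑ j, u j n • m j := by
  constructor
  · rintro ⟨t, ht⟩
    obtain ⟨S, rfl⟩ := TensorProduct.exists_finset t
    refine ⟨S.card, fun j => (S.equivFin.symm j).1.1, fun j => (S.equivFin.symm j).1.2,
      fun n => ?_⟩
    have := LinearMap.congr_fun ht n
    simp only [map_sum, LinearMap.sum_apply, dualTensorHom_apply] at this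
    rw [S.equivFin.symm.sum_comp (fun i : S => i.1.1 n • i.1.2)]
    rw [Finset.sum_coe_sort S (fun i => i.1 n • i.2), this]
    simp
  · rintro ⟨k, u, m, h⟩
    refine ⟨∑ j, u j ⊗ₜ m j, ?_⟩
    ext n
    simp [LinearMap.sum_apply, dualTensorHom_apply, h]

lemma freeFactorIdeal_le_of_exact {F Y : Type} [AddCommGroup F] [AddCommGroup Y] [Module A F]
    [Module A Y] [Module.Free A F] [Module.Finite A F] (f : N →ₗ[A] F) (g : F →ₗ[A] Y)
    (hf : Function.Injective f) (h : Function.Exact f g) (hg : Function.Surjective g) :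
    freeFactorIdeal A Y ≤ freeFactorIdeal A N := by
  intro a ha
  obtain ⟨k, u, m, hu⟩ := mem_freeFactorIdeal_iff.mp ha
  choose s hs using hg
  let σ : Y →ₗ[A] F := ∑ j, (u j).smulRight (s (m j))
  have hσ (y : Y) : g (σ y) = a • y := by
    simp [σ, LinearMap.sum_apply, hs, hu]
  let τ : F →ₗ[A] F := a • LinearMap.id - σ ∘ₗ g
  have hτ (z : F) : ∃ n, f n = τ z := (h _).mp (by simp [τ, hσ])
  let e := LinearEquiv.ofInjective f hf
  let ρ : F →ₗ[A] N := e.symm.toLinearMap ∘ₗ τ.codRestrict (LinearMap.range f) hτ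
  have hρ (z : F) : f (ρ z) = τ z := by
    exact congrArg Subtype.val (e.apply_symm_apply (τ.codRestrict (LinearMap.range f) hτ z))
  let b := Module.Free.chooseBasis A F
  let t : Module.Free.ChooseBasisIndex A F ≃ Fin _ := Fintype.equivFin _
  refine mem_freeFactorIdeal_iff.mpr ⟨_, fun j => b.coord (t.symm j) ∘ₗ f,
    fun j => ρ (b (t.symm j)), fun n => hf ?_⟩
  have h0 : g (f n) = 0 := h.apply_apply_eq_zero n
  rw [map_smul]
  have h1 : a • f n = τ (f n) := by simp [τ, h0]
  rw [h1, ← hρ]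
  congr 1
  have h2 : ρ (f n) = ∑ i, b.repr (f n) i • ρ (b i) := by
    conv_lhs => rw [← b.sum_repr (f n)]
    rw [map_sum]
    simp only [map_smul]
  rw [h2, t.symm.sum_comp (fun i => (b.coord i ∘ₗ f) n • ρ (b i))]
  rfl

lemma ExtZero.of_mem_freeFactorIdeal {X : Type} [AddCommGroup X] [Module A X] {x : A} {c : ℕ}
    (hx : x ^ c ∈ freeFactorIdeal A N) (hb : Function.Bijective fun v : X => x • v) {i : ℕ}
    (hi : i ≠ 0) : ExtZero A i N X := by
  obtain ⟨k, u, m, hu⟩ := mem_freeFactorIdeal_iff.mp hx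
  refine ExtZero.of_smul_bijective hi u m hu ?_
  have := hb.iterate c
  rwa [smul_iterate] at this

end FreeFactor

lemma IsSyz.of_succ {j : ℕ} : ∀ {L : Type} [AddCommGroup L] [Module A L],
    IsSyz A (j + 1) L → IsSyz A j L := by
  induction j with
  | zero => intros; trivial
  | succ j ih =>
    rintro L _ _ ⟨F, L', _, _, _, _, f, g, h1, h2, h3, h4, h5, h6⟩
    exact ⟨F, L', _, _, _, _, f, g, h1, h2, h3, h4, h5, ih h6⟩

lemma SyzFlat.zero : SyzFlat A 0 A := by
  intro N F L _ _ _ _ _ _ _ _ f g hf _ _ _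
  exact Module.Flat.rTensor_preserves_injective_linearMap f hf

/-- Passing to a module `B` all of whose elements are `x`-power torsion, with `x` surjective. -/
lemma RegSocle.of_ker (m : Ideal A) (x : A) (l : List A) : ∀ {V B : Type} [AddCommGroup V]
    [AddCommGroup B] [Module A V] [Module A B] (j : V →ₗ[A] B), Function.Injective j →
    (∀ b : B, x • b = 0 ↔ ∃ v, j v = b) → (∀ b : B, ∃ c : B, x • c = b) →
    (∀ b : B, ∃ k : ℕ, x ^ k • b = 0) → RegSocle m l V → RegSocle m l B := by
  induction l with
  | nil =>
    rintro V B _ _ _ _ j hj - - - ⟨σ, hσ, hm⟩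
    refine ⟨j σ, fun h => hσ (hj (by simpa using h)), fun z hz => ?_⟩
    rw [← map_smul, hm z hz, map_zero]
  | cons y l ih =>
    rintro V B _ _ _ _ j hj hker hsurj htor ⟨hy, hV⟩
    have hyB : ∀ (k : ℕ) (b : B), x ^ k • b = 0 → y • b = 0 → b = 0 := by
      intro k
      induction k with
      | zero => intro b hb _; simpa using hb
      | succ k ihk =>
        intro b hb hyb
        have hxb : x • b = 0 := ihk (x • b) (by rw [← mul_smul, ← pow_succ, hb])
          (by rw [smul_comm, hyb, smul_zero])
        obtain ⟨v, rfl⟩ := (hker b).mp hxb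
        rw [← map_smul] at hyb
        have : y • v = 0 := hj (by simpa using hyb)
        rw [hy.right_eq_zero_of_smul this, map_zero]
    have hyB0 (b : B) (hb : y • b = 0) : b = 0 := by
      obtain ⟨k, hk⟩ := htor b
      exact hyB k b hk hb
    have mk_zero {W : Type} [AddCommGroup W] [Module A W] (w : W) :
        ((Submodule.mkQ _ w : QuotSMulTop y W) = 0) ↔ ∃ w', y • w' = w := by
      rw [Submodule.mkQ_apply, Submodule.Quotient.mk_eq_zero,
        Submodule.mem_smul_pointwise_iff_exists]
      simp
    refine ⟨isSMulRegular_iff_right_eq_zero_of_smul.mpr (fun b => hyB0 b),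
      ih (QuotSMulTop.map y j) ?_ ?_ ?_ ?_ hV⟩
    · rw [← LinearMap.ker_eq_bot, LinearMap.ker_eq_bot']
      intro v hv
      obtain ⟨v, rfl⟩ := Submodule.mkQ_surjective _ v
      obtain ⟨b, hb⟩ := (mk_zero (j v)).mp hv
      have hxb : x • b = 0 := hyB0 _ (by
        rw [smul_comm, hb, (hker _).mpr ⟨v, rfl⟩])
      obtain ⟨w, rfl⟩ := (hker b).mp hxb
      rw [← map_smul] at hb
      exact (mk_zero v).mpr ⟨w, hj hb⟩
    · intro b
      obtain ⟨b, rfl⟩ := Submodule.mkQ_surjective _ b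
      constructor
      · intro hb
        rw [← map_smul] at hb
        obtain ⟨b', hb'⟩ := (mk_zero _).mp hb
        obtain ⟨c, rfl⟩ := hsurj b'
        obtain ⟨v, hv⟩ := (hker (b - y • c)).mp (by rw [smul_sub, ← hb', smul_comm, sub_self])
        refine ⟨Submodule.mkQ _ v, ?_⟩
        change Submodule.mkQ _ (j v) = _
        rw [hv, map_sub, (mk_zero (y • c)).mpr ⟨c, rfl⟩, sub_zero]
      · rintro ⟨v, hv⟩
        obtain ⟨v, rfl⟩ := Submodule.mkQ_surjective _ v
        rw [← hv, ← map_smul, ← map_smul]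
        change Submodule.mkQ _ (j (x • v)) = 0
        rw [map_smul, (hker _).mpr ⟨v, rfl⟩, map_zero]
    · intro b
      obtain ⟨b, rfl⟩ := Submodule.mkQ_surjective _ b
      obtain ⟨c, rfl⟩ := hsurj b
      exact ⟨Submodule.mkQ _ c, rfl⟩
    · intro b
      obtain ⟨b, rfl⟩ := Submodule.mkQ_surjective _ b
      obtain ⟨k, hk⟩ := htor b
      exact ⟨k, by rw [← map_smul, hk, map_zero]⟩

namespace LocStep

/-- The localization away from a nonzerodivisor gives such a sequence. -/
lemma exists_of_isSMulRegular {x : A} {V : Type} [AddCommGroup V] [Module A V]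
    (hx : IsSMulRegular V x) : ∃ (V' V'' : Type) (_ : AddCommGroup V') (_ : AddCommGroup V'')
      (_ : Module A V') (_ : Module A V'') (ι : V →ₗ[A] V') (π : V' →ₗ[A] V''),
      LocStep x ι π := by
  let S := Submonoid.powers x
  let ι := LocalizedModule.mkLinearMap S V
  refine ⟨LocalizedModule S V, LocalizedModule S V ⧸ LinearMap.range ι, inferInstance,
    inferInstance, inferInstance, inferInstance, ι, Submodule.mkQ _, ?_, ?_, ?_, ?_, ?_⟩
  · rw [← LinearMap.ker_eq_bot, LinearMap.ker_eq_bot']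
    intro v hv
    obtain ⟨⟨_, k, rfl⟩, hs⟩ := (IsLocalizedModule.eq_zero_iff S ι).mp hv
    exact (hx.pow k).right_eq_zero_of_smul hs
  · exact LinearMap.exact_map_mkQ_range ι
  · exact Submodule.mkQ_surjective _
  · have := IsLocalizedModule.map_units ι ⟨x, Submonoid.mem_powers x⟩
    exact (Module.End.isUnit_iff _).mp this
  · intro v
    obtain ⟨⟨w, ⟨_, k, rfl⟩⟩, hw⟩ := IsLocalizedModule.surj S ι v
    exact ⟨k, w, hw⟩

variable {x : A} {V V' V'' : Type} [AddCommGroup V]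
    [AddCommGroup V'] [AddCommGroup V''] [Module A V] [Module A V'] [Module A V'']
    {ι : V →ₗ[A] V'} {π : V' →ₗ[A] V''} (H : LocStep x ι π)
include H

lemma regSocle (m : Ideal A) (l : List A) (h : RegSocle m (x :: l) V) : RegSocle m l V'' := by
  obtain ⟨hx, hl⟩ := h
  let e : V' ≃ₗ[A] V' := LinearEquiv.ofBijective (LinearMap.lsmul A V' x) H.bij
  have he (v : V') : x • e.symm v = v := e.apply_symm_apply v
  have he' (v : V') : e.symm (x • v) = v := e.symm_apply_apply v
  let j : QuotSMulTop x V →ₗ[A] V'' := Submodule.liftQ _ (π ∘ₗ e.symm.toLinearMap ∘ₗ ι) (by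
    rintro _ hv
    obtain ⟨v, -, rfl⟩ := (Submodule.mem_smul_pointwise_iff_exists _ _ _).mp hv
    change π (e.symm (ι (x • v))) = 0
    rw [map_smul, he', H.exact.apply_apply_eq_zero])
  have hj (v : V) : j (Submodule.mkQ _ v) = π (e.symm (ι v)) := rfl
  refine RegSocle.of_ker m x l j ?_ ?_ ?_ ?_ hl
  · rw [← LinearMap.ker_eq_bot, LinearMap.ker_eq_bot']
    intro v hv
    obtain ⟨v, rfl⟩ := Submodule.mkQ_surjective _ v
    rw [hj] at hv
    obtain ⟨w, hw⟩ := (H.exact _).mp hv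
    have : x • w = v := H.inj (by rw [map_smul, hw, he])
    rw [Submodule.mkQ_apply, Submodule.Quotient.mk_eq_zero]
    exact (Submodule.mem_smul_pointwise_iff_exists _ _ _).mpr ⟨w, trivial, this⟩
  · intro b
    obtain ⟨v, rfl⟩ := H.surj b
    constructor
    · intro hb
      rw [← map_smul] at hb
      obtain ⟨w, hw⟩ := (H.exact _).mp hb
      exact ⟨Submodule.mkQ _ w, by rw [hj, hw, he']⟩
    · rintro ⟨w, hw⟩
      obtain ⟨w, rfl⟩ := Submodule.mkQ_surjective _ w
      rw [← hw, hj, ← map_smul, he, H.exact.apply_apply_eq_zero]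
  · intro b
    obtain ⟨v, rfl⟩ := H.surj b
    exact ⟨π (e.symm v), by rw [← map_smul, he]⟩
  · intro b
    obtain ⟨v, rfl⟩ := H.surj b
    obtain ⟨k, w, hw⟩ := H.clear v
    exact ⟨k, by rw [← map_smul, hw, H.exact.apply_apply_eq_zero]⟩

lemma lTensor_bij (N : Type) [AddCommGroup N] [Module A N] :
    Function.Bijective fun t : N ⊗[A] V' => x • t := by
  let e : V' ≃ₗ[A] V' := LinearEquiv.ofBijective (LinearMap.lsmul A V' x) H.bij
  have : (fun t : N ⊗[A] V' => x • t) = e.lTensor N := by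
    ext t
    induction t with
    | zero => simp
    | tmul n v => exact (TensorProduct.tmul_smul x n v).symm
    | add a b ha hb => simp only [smul_add, map_add] at *; rw [ha, hb]
  rw [this]
  exact (e.lTensor N).bijective

lemma lTensor_clear (N : Type) [AddCommGroup N] [Module A N] (t : N ⊗[A] V') :
    ∃ (k : ℕ) (s : N ⊗[A] V), x ^ k • t = ι.lTensor N s := by
  induction t with
  | zero => exact ⟨0, 0, by simp⟩
  | tmul n v =>
    obtain ⟨k, w, hw⟩ := H.clear v
    exact ⟨k, n ⊗ₜ w, by simp [← hw]⟩
  | add a b ha hb =>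
    obtain ⟨k, s, hs⟩ := ha
    obtain ⟨k', s', hs'⟩ := hb
    refine ⟨k + k', x ^ k' • s + x ^ k • s', ?_⟩
    rw [map_add, map_smul, map_smul, ← hs, ← hs', smul_add, ← mul_smul, ← mul_smul, pow_add,
      mul_comm]

variable {N F : Type} [AddCommGroup N] [AddCommGroup F] [Module A N] [Module A F]
    [Module.Free A F] (f : N →ₗ[A] F) (hf : Function.Injective (f.rTensor V))
include hf

lemma lTensor_inj : Function.Injective (ι.lTensor N) := by
  have h1 : Function.Injective (ι.lTensor F ∘ₗ f.rTensor V) :=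
    (Module.Flat.lTensor_preserves_injective_linearMap ι H.inj).comp hf
  rw [LinearMap.lTensor_comp_rTensor, ← LinearMap.rTensor_comp_lTensor] at h1
  exact Function.Injective.of_comp h1

lemma rTensor_inj : Function.Injective (f.rTensor V') := by
  rw [← LinearMap.ker_eq_bot, LinearMap.ker_eq_bot']
  intro t ht
  obtain ⟨k, s, hs⟩ := H.lTensor_clear N t
  have h1 : ι.lTensor F (f.rTensor V s) = 0 := by
    have := LinearMap.congr_fun
      ((LinearMap.lTensor_comp_rTensor _ f ι).trans (LinearMap.rTensor_comp_lTensor _ f ι).symm) s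
    simp only [LinearMap.comp_apply] at this
    rw [this, ← hs, map_smul, ht, smul_zero]
  have h2 : s = 0 := hf ((Module.Flat.lTensor_preserves_injective_linearMap ι H.inj)
    (by rw [h1, map_zero, map_zero]))
  rw [h2, map_zero] at hs
  have := (H.lTensor_bij N).iterate k
  rw [smul_iterate] at this
  exact this.1 (by simpa using hs)

omit hf in
lemma syzFlat {j : ℕ} (h : SyzFlat A j V) : SyzFlat A (j + 1) V'' := by
  intro N F L _ _ _ _ _ _ _ _ f g hf hfg hg hL
  have hNV := h N F L f g hf hfg hg hL.of_succ
  obtain ⟨F', L', _, _, _, _, f', g', _, _, hf', hfg', hg', hL'⟩ := hL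
  have hLV := H.lTensor_inj f' (h L F' L' f' g' hf' hfg' hg' hL')
  have hNV' := H.rTensor_inj f hNV
  rw [← LinearMap.ker_eq_bot, LinearMap.ker_eq_bot']
  intro t ht
  obtain ⟨t, rfl⟩ := LinearMap.lTensor_surjective N H.surj t
  have comm {M₁ M₂ W W' : Type} [AddCommGroup M₁] [AddCommGroup M₂] [AddCommGroup W]
      [AddCommGroup W'] [Module A M₁] [Module A M₂] [Module A W] [Module A W']
      (p : M₁ →ₗ[A] M₂) (q : W →ₗ[A] W') (s : M₁ ⊗[A] W) :
      q.lTensor M₂ (p.rTensor W s) = p.rTensor W' (q.lTensor M₁ s) :=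
    LinearMap.congr_fun
      ((LinearMap.lTensor_comp_rTensor _ p q).trans (LinearMap.rTensor_comp_lTensor _ p q).symm) s
  rw [← comm] at ht
  obtain ⟨u, hu⟩ := (lTensor_exact F H.exact H.surj _).mp ht
  have h1 : g.rTensor V u = 0 := hLV (by
    rw [comm, hu, ← LinearMap.comp_apply, ← LinearMap.rTensor_comp, hfg.linearMap_comp_eq_zero,
      LinearMap.rTensor_zero, LinearMap.zero_apply, map_zero])
  obtain ⟨s, rfl⟩ := (rTensor_exact V hfg hg _).mp h1
  rw [comm] at hu
  rw [← hNV' hu]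
  exact (lTensor_exact N H.exact H.surj).apply_apply_eq_zero s

lemma extZero {c i : ℕ} (hc : x ^ c ∈ freeFactorIdeal A N) (hi : i ≠ 0)
    (h : ExtZero A (i + 1) N (N ⊗[A] V)) : ExtZero A i N (N ⊗[A] V'') :=
  ExtZero.covariant_right (H.lTensor_inj f hf) (lTensor_exact N H.exact H.surj)
    (LinearMap.lTensor_surjective N H.surj)
    (ExtZero.of_mem_freeFactorIdeal hc (H.lTensor_bij N) hi) h

end LocStep

/-- Contraction of the first tensor factor with a linear form. -/
noncomputable def evTensor {N : Type} [AddCommGroup N] [Module A N] (f : N →ₗ[A] A) (C : Type)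
    [AddCommGroup C] [Module A C] : N ⊗[A] C →ₗ[A] C :=
  (TensorProduct.lid A C).toLinearMap ∘ₗ f.rTensor C

section evTensor

variable {N C D : Type} [AddCommGroup N] [Module A N] [AddCommGroup C] [Module A C]
  [AddCommGroup D] [Module A D]

@[simp]
lemma evTensor_tmul (f : N →ₗ[A] A) (n : N) (c : C) : evTensor f C (n ⊗ₜ c) = f n • c := by
  simp [evTensor]

lemma evTensor_lTensor (f : N →ₗ[A] A) (δ : C →ₗ[A] D) (t : N ⊗[A] C) :
    evTensor f D (δ.lTensor N t) = δ (evTensor f C t) := by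
  induction t with
  | zero => simp
  | tmul n c => simp
  | add a b ha hb => simp only [map_add, ha, hb]

lemma smul_evTensor {a : A} {k : ℕ} {u : Fin k → N →ₗ[A] A} {m : Fin k → N}
    (hu : ∀ n, a • n = ∑ j, u j n • m j) (f : N →ₗ[A] A) (t : N ⊗[A] C) :
    a • evTensor f C t = ∑ j, f (m j) • evTensor (u j) C t := by
  induction t with
  | zero => simp
  | tmul n c =>
    rw [evTensor_tmul, ← mul_smul, ← smul_eq_mul, ← map_smul, hu, map_sum, Finset.sum_smul]
    refine Finset.sum_congr rfl fun j _ => ?_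
    rw [evTensor_tmul, map_smul, smul_eq_mul, mul_comm, mul_smul]
  | add a b ha hb => simp only [map_add, smul_add, ha, hb, Finset.sum_add_distrib]

/-- A contraction lies in the range of `δ` if the corresponding rank one map lifts to
`N → N ⊗ C`. -/
lemma evTensor_mem_range {x y : A} {c c' : ℕ} (hx : x ^ c ∈ freeFactorIdeal A N)
    (hy : y ^ c' ∈ freeFactorIdeal A N) (hC : Function.Bijective fun v : C => x • v)
    (hD : Function.Bijective fun v : D => y • v) (δ : C →ₗ[A] D) (ψ : N →ₗ[A] N ⊗[A] C)
    (f : N →ₗ[A] A) (ζ : N ⊗[A] D) (h : ∀ n, δ.lTensor N (ψ n) = f n • ζ) :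
    ∃ v : C, δ v = evTensor f D ζ := by
  obtain ⟨k, u, m, hu⟩ := mem_freeFactorIdeal_iff.mp hx
  obtain ⟨k', u', m', hu'⟩ := mem_freeFactorIdeal_iff.mp hy
  have hC' := hC.iterate c
  have hD' := hD.iterate c'
  rw [smul_iterate] at hC' hD'
  let T : C := ∑ i, evTensor (u i) C (ψ (m i))
  let T' : C := ∑ i, evTensor (u' i) C (ψ (m' i))
  have hT : y ^ c' • T = x ^ c • T' := by
    simp only [T, T', Finset.smul_sum]
    rw [Finset.sum_congr rfl (fun i _ => smul_evTensor hu (u' i) (ψ (m' i)))]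
    rw [Finset.sum_congr rfl (g := fun i => ∑ j, u' j (m i) • evTensor (u i) C (ψ (m' j)))]
    · rw [Finset.sum_comm]
    · intro i _
      rw [← map_smul, ← map_smul, hu', map_sum, map_sum]
      simp only [map_smul]
  obtain ⟨v, hv⟩ := hC'.2 T
  change x ^ c • v = T at hv
  have hT' : T' = y ^ c' • v := hC'.1 (by
    change x ^ c • T' = x ^ c • _
    rw [← hT, ← hv, smul_comm])
  refine ⟨v, hD'.1 ?_⟩
  change y ^ c' • _ = y ^ c' • _
  rw [smul_evTensor hu', ← map_smul, ← hT', map_sum]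
  refine Finset.sum_congr rfl fun i _ => ?_
  rw [← evTensor_lTensor, h, map_smul]

end evTensor

lemma IsSyz.mono {L : Type} [AddCommGroup L] [Module A L] {i j : ℕ} (hij : i ≤ j)
    (h : IsSyz A j L) : IsSyz A i L := by
  induction hij with
  | refl => exact h
  | step _ ih => exact ih h.of_succ

/-- Iterating the passage from `V` to `V_x / V` along a regular sequence. -/
lemma exists_regSocle_chain (m : Ideal A) (l l' : List A) : ∀ {j : ℕ} {V : Type} [AddCommGroup V]
    [Module A V], SyzFlat A j V → RegSocle m (l ++ l') V →
    ∃ (W : Type) (_ : AddCommGroup W) (_ : Module A W), SyzFlat A (j + l.length) W ∧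
      RegSocle m l' W ∧
      ∀ (N F L : Type) [AddCommGroup N] [AddCommGroup F] [AddCommGroup L] [Module A N]
        [Module A F] [Module A L] [Module.Free A F] [Module.Finite A F] (f : N →ₗ[A] F)
        (g : F →ₗ[A] L), Function.Injective f → Function.Exact f g → Function.Surjective g →
        IsSyz A (j + l.length) L → (∀ z ∈ l, ∃ c : ℕ, z ^ c ∈ freeFactorIdeal A N) →
        ∀ i : ℕ, i ≠ 0 → ExtZero A (i + l.length) N (N ⊗[A] V) → ExtZero A i N (N ⊗[A] W) := by
  induction l with
  | nil =>
    intro j V _ _ hV hs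
    exact ⟨V, _, _, hV, hs, fun N F L _ _ _ _ _ _ _ _ f g _ _ _ _ _ i _ h => h⟩
  | cons x l ih =>
    intro j V _ _ hV hs
    obtain ⟨V', V'', _, _, _, _, ι, π, H⟩ := LocStep.exists_of_isSMulRegular hs.1
    obtain ⟨W, _, _, h1, h2, h3⟩ := ih (H.syzFlat hV) (H.regSocle m _ hs)
    have hlen : j + (x :: l).length = j + 1 + l.length := by simp; ring
    refine ⟨W, _, _, hlen ▸ h1, h2, ?_⟩
    intro N F L _ _ _ _ _ _ _ _ f g hf hfg hg hL hl i hi hext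
    obtain ⟨c, hc⟩ := hl x (by simp)
    refine h3 N F L f g hf hfg hg (hlen ▸ hL) (fun z hz => hl z (by simp [hz])) i hi
      (H.extZero f (hV N F L f g hf hfg hg (hL.mono (by simp))) hc (by omega) ?_)
    have : i + (x :: l).length = i + l.length + 1 := by simp; ring
    exact this ▸ hext

lemma tmul_eq_zero_of_mem_smul_top {m : Ideal A} {F V : Type} [AddCommGroup F] [Module A F]
    [AddCommGroup V] [Module A V] {σ : V} (hσ : ∀ z ∈ m, z • σ = 0) {t : F}
    (ht : t ∈ m • (⊤ : Submodule A F)) : t ⊗ₜ[A] σ = 0 := by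
  induction ht using Submodule.smul_induction_on' with
  | smul z hz n _ => rw [TensorProduct.smul_tmul, hσ z hz, TensorProduct.tmul_zero]
  | add a _ b _ ha hb => rw [TensorProduct.add_tmul, ha, hb, add_zero]

section core

variable {m : Ideal A} {Y F' L : Type} [AddCommGroup Y] [AddCommGroup F'] [AddCommGroup L]
  [Module A Y] [Module A F'] [Module A L] [Module.Free A F'] [Module.Finite A F']
  (f₁ : L →ₗ[A] F') (g₁ : F' →ₗ[A] Y) (hf₁ : Function.Injective f₁)
  (h₁ : Function.Exact f₁ g₁) (hg₁ : Function.Surjective g₁)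
  (hm₁ : LinearMap.range f₁ ≤ m • (⊤ : Submodule A F'))
include hf₁ h₁ hg₁ hm₁

/-- A free minimal first syzygy of a sufficiently high syzygy vanishes. -/
lemma subsingleton_of_free_syzygy [Module.Free A L] {l : List A} (hl : RegSocle m l A)
    (hY : IsSyz A l.length Y) : Subsingleton L := by
  obtain ⟨W, _, _, hW, ⟨σ, hσ, hmσ⟩, -⟩ :=
    exists_regSocle_chain m l [] SyzFlat.zero (by simpa using hl)
  rw [zero_add] at hW
  have hinj := hW L F' Y f₁ g₁ hf₁ h₁ hg₁ hY
  let b := Module.Free.chooseBasis A L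
  suffices h : IsEmpty (Module.Free.ChooseBasisIndex A L) by
    exact b.repr.toEquiv.subsingleton
  refine ⟨fun i => hσ ?_⟩
  have h0 : b i ⊗ₜ[A] σ = 0 := hinj (by
    rw [LinearMap.rTensor_tmul, tmul_eq_zero_of_mem_smul_top hmσ (hm₁ ⟨_, rfl⟩), map_zero])
  have := congrArg (evTensor (b.coord i) W) h0
  simpa using this

/-- The minimal second syzygy of a sufficiently high syzygy `Y` vanishes when it has no
self-extension in the relevant degree and is locally free on a punctured neighbourhood. -/
lemma subsingleton_of_ext_syzygy {N F : Type} [AddCommGroup N] [AddCommGroup F] [Module A N]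
    [Module A F] [Module.Free A F] [Module.Finite A F] (f₂ : N →ₗ[A] F) (g₂ : F →ₗ[A] L)
    (hf₂ : Function.Injective f₂) (h₂ : Function.Exact f₂ g₂) (hg₂ : Function.Surjective g₂)
    (hm₂ : LinearMap.range f₂ ≤ m • (⊤ : Submodule A F)) {l : List A} {x y : A}
    (hl : RegSocle m (l ++ [x, y]) A) (hY : IsSyz A (l.length + 2) Y)
    (hN : ∀ z ∈ l ++ [x, y], ∃ c : ℕ, z ^ c ∈ freeFactorIdeal A N)
    (hext : ExtZero A (l.length + 1) N N) : Subsingleton L := by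
  have hL : IsSyz A (l.length + 3) L := ⟨F', Y, _, _, _, _, f₁, g₁, inferInstance, inferInstance,
    hf₁, h₁, hg₁, hY⟩
  obtain ⟨U, _, _, hU, hsU, hUext⟩ := exists_regSocle_chain m l [x, y] SyzFlat.zero hl
  rw [zero_add] at hU
  have hext1 : ExtZero A 1 N (N ⊗[A] U) :=
    hUext N F L f₂ g₂ hf₂ h₂ hg₂ (hL.mono (by omega)) (fun z hz => hN z (by simp [hz])) 1
      one_ne_zero ((add_comm _ 1 ▸ hext).congr_right (TensorProduct.rid A N).symm)
  obtain ⟨C, U', _, _, _, _, ι, π, H⟩ := LocStep.exists_of_isSMulRegular hsU.1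
  have hU' := H.syzFlat hU
  have hsU' := H.regSocle m _ hsU
  obtain ⟨D, W, _, _, _, _, ι', π', H'⟩ := LocStep.exists_of_isSMulRegular hsU'.1
  have hW := H'.syzFlat hU'
  obtain ⟨σ, hσ, hmσ⟩ := H'.regSocle m _ hsU'
  obtain ⟨c, hc⟩ := hN x (by simp)
  obtain ⟨c', hc'⟩ := hN y (by simp)
  let b := Module.Free.chooseBasis A F
  suffices h : IsEmpty (Module.Free.ChooseBasisIndex A F) by
    have : Subsingleton F := b.repr.toEquiv.subsingleton
    exact hg₂.subsingleton
  refine ⟨fun i => hσ ?_⟩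
  have hLW : Function.Injective (f₁.rTensor W) := hW L F' Y f₁ g₁ hf₁ h₁ hg₁ hY
  have hNW : Function.Injective (f₂.rTensor W) := hW N F L f₂ g₂ hf₂ h₂ hg₂ hL.of_succ
  have hNU : Function.Injective (f₂.rTensor U) := hU N F L f₂ g₂ hf₂ h₂ hg₂ (hL.mono (by omega))
  have hNU' : Function.Injective (f₂.rTensor U') :=
    hU' N F L f₂ g₂ hf₂ h₂ hg₂ (hL.mono (by omega))
  have h0 : g₂ (b i) ⊗ₜ[A] σ = 0 := hLW (by
    rw [LinearMap.rTensor_tmul, tmul_eq_zero_of_mem_smul_top hmσ (hm₁ ⟨_, rfl⟩), map_zero])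
  obtain ⟨ζ, hζ⟩ := (rTensor_exact W h₂ hg₂ (b i ⊗ₜ σ)).mp (by rw [LinearMap.rTensor_tmul, h0])
  have hmζ : ∀ z ∈ m, z • ζ = 0 := fun z hz => hNW (by
    rw [map_smul, hζ, ← TensorProduct.tmul_smul, hmσ z hz, TensorProduct.tmul_zero, map_zero])
  let f : N →ₗ[A] A := b.coord i ∘ₗ f₂
  have hfm (n : N) : f n ∈ m := by
    have : f₂ n ∈ m • (⊤ : Submodule A F) := hm₂ ⟨n, rfl⟩
    have := Submodule.mem_map_of_mem (f := b.coord i) this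
    rw [Submodule.map_smul''] at this
    exact Submodule.smul_le.mpr (fun r hr s _ => Ideal.mul_mem_right s m hr) this
  have hev : evTensor f W ζ = σ := by
    have : evTensor f W ζ = evTensor (b.coord i) W (f₂.rTensor W ζ) := by
      simp [evTensor, f, LinearMap.rTensor_comp]
    rw [this, hζ]
    simp
  obtain ⟨ζ', rfl⟩ := LinearMap.lTensor_surjective N H'.surj ζ
  have hexU' := lTensor_exact N H'.exact H'.surj
  have hinjU' := H'.lTensor_inj f₂ hNU'
  let e := LinearEquiv.ofInjective (ι'.lTensor N) hinjU'
  let φ : N →ₗ[A] N ⊗[A] U' := e.symm.toLinearMap ∘ₗ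
    (f.smulRight ζ').codRestrict (LinearMap.range (ι'.lTensor N)) (fun n => (hexU' _).mp (by
      rw [LinearMap.smulRight_apply, map_smul, hmζ _ (hfm n)]))
  have hφ (n : N) : ι'.lTensor N (φ n) = f n • ζ' :=
    congrArg Subtype.val (e.apply_symm_apply _)
  obtain ⟨ψ, hψ⟩ := ExtZero.exists_lift (H.lTensor_inj f₂ hNU) (lTensor_exact N H.exact H.surj)
    (LinearMap.lTensor_surjective N H.surj) hext1 φ
  obtain ⟨v, hv⟩ := evTensor_mem_range hc hc' H.bij H'.bij (ι' ∘ₗ π) ψ f ζ' (fun n => by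
    rw [LinearMap.lTensor_comp, LinearMap.comp_apply, ← hφ, ← hψ]
    rfl)
  rw [← hev, evTensor_lTensor, ← hv]
  exact H'.exact.apply_apply_eq_zero _

end core

end tensorSteps

section localRing

variable {A : Type} [CommRing A] [IsLocalRing A]

lemma exists_minimal_cover (Y : Type) [AddCommGroup Y] [Module A Y] [Module.Finite A Y] :
    ∃ (n : ℕ) (g : (Fin n → A) →ₗ[A] Y), Function.Surjective g ∧
      LinearMap.ker g ≤ maximalIdeal A • (⊤ : Submodule A (Fin n → A)) := by
  let b := Module.finBasis (ResidueField A) (ResidueField A ⊗[A] Y)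
  have hs : Function.Surjective (TensorProduct.mk A (ResidueField A) Y 1) :=
    TensorProduct.mk_surjective A Y (ResidueField A) Ideal.Quotient.mk_surjective
  choose s hs using hs
  have hspan : Submodule.span A (Set.range fun i => s (b i)) = ⊤ :=
    IsLocalRing.span_eq_top_of_tmul_eq_basis _ b fun i => hs _
  refine ⟨_, Fintype.linearCombination A (fun i => s (b i)), ?_, ?_⟩
  · rw [← LinearMap.range_eq_top, Fintype.range_linearCombination, hspan]
  · intro v hv
    have h0 : ∑ i, residue A (v i) • b i = 0 := by
      have := congrArg (TensorProduct.mk A (ResidueField A) Y 1) (LinearMap.mem_ker.mp hv)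
      rw [Fintype.linearCombination_apply, map_sum, map_zero] at this
      rw [← this]
      refine Finset.sum_congr rfl fun i _ => ?_
      rw [map_smul, hs, ← IsScalarTower.algebraMap_smul (ResidueField A)]
      rfl
    have h1 (i) : v i ∈ maximalIdeal A :=
      (residue_eq_zero_iff _).mp (Fintype.linearIndependent_iff.mp b.linearIndependent _ h0 i)
    rw [← Finset.univ_sum_single v]
    refine Submodule.sum_mem _ fun i _ => ?_
    have : Pi.single i (v i) = v i • (Pi.single i 1 : Fin _ → A) := by
      rw [← Pi.single_smul]; simp
    rw [this]
    exact Submodule.smul_mem_smul (h1 i) trivial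

section shift

variable {Y F K : Type} [AddCommGroup Y] [AddCommGroup F] [AddCommGroup K] [Module A Y]
  [Module A F] [Module A K] [Module.Free A F] [Module.Finite A F]
  (f : K →ₗ[A] F) (g : F →ₗ[A] Y) (hf : Function.Injective f)
  (h : Function.Exact f g) (hg : Function.Surjective g)
include hf h hg

omit [IsLocalRing A] [Module.Finite A F] in
lemma ExtZero.syzygy {i : ℕ} (hi : i ≠ 0) {X : Type} [AddCommGroup X] [Module A X]
    (hY : ExtZero A (i + 1) Y X) : ExtZero A i K X :=
  ExtZero.contravariant_left hf h hg (ExtZero.of_projective i hi) hY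

omit [IsLocalRing A] in
lemma ExtZero.syzygy_self {i : ℕ} (hi : i ≠ 0) (hY : ExtZero A i Y Y)
    (hA : ExtZero A (i + 1) Y A) : ExtZero A i K K :=
  ExtZero.syzygy f g hf h hg hi (ExtZero.covariant_left hf h hg hY hA.of_free)

omit [Module.Finite A F] in
lemma free_of_free_syzygy [Module.Finite A Y] [Module.Free A K] [Module.Finite A K]
    (hY : ExtZero A 1 Y A) : Module.Free A Y := by
  obtain ⟨s, hs⟩ := ExtZero.exists_lift hf h hg hY.of_free LinearMap.id
  have : Module.Projective A Y := Module.Projective.of_split s g hs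
  exact Module.free_of_flat_of_isLocalRing

end shift

omit [IsLocalRing A] in
lemma free_of_subsingleton_ker {Y F : Type} [AddCommGroup Y] [AddCommGroup F] [Module A Y]
    [Module A F] [Module.Free A F] {g : F →ₗ[A] Y} (hg : Function.Surjective g)
    (h : Subsingleton (LinearMap.ker g)) : Module.Free A Y :=
  Module.Free.of_equiv (LinearEquiv.ofBijective g
    ⟨LinearMap.ker_eq_bot.mp (Submodule.subsingleton_iff_eq_bot.mp h), hg⟩)

omit [IsLocalRing A] in
lemma exact_ker_subtype {Y F : Type} [AddCommGroup Y] [AddCommGroup F] [Module A Y]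
    [Module A F] (g : F →ₗ[A] Y) : Function.Exact (LinearMap.ker g).subtype g :=
  LinearMap.exact_subtype_ker_map g

variable [IsNoetherianRing A]

/-- Descending through syzygies to reduce freeness to the case of an `e`-th syzygy. -/
lemma free_of_descent (e : ℕ) (P : ∀ (Y : Type) [AddCommGroup Y] [Module A Y], Prop)
    (hP : ∀ (Y F : Type) [AddCommGroup Y] [AddCommGroup F] [Module A Y] [Module A F]
      [Module.Free A F] [Module.Finite A F] (g : F →ₗ[A] Y), Function.Surjective g → P Y →
      (∀ i, 1 ≤ i → i ≤ e + 1 → ExtZero A i Y A) → P (LinearMap.ker g))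
    (hbase : ∀ (Y : Type) [AddCommGroup Y] [Module A Y] [Module.Finite A Y], P Y → IsSyz A e Y →
      (∀ i, 1 ≤ i → i ≤ e + 1 → ExtZero A i Y A) → Module.Free A Y) (k : ℕ) :
    ∀ (s : ℕ) (Y : Type) [AddCommGroup Y] [Module A Y] [Module.Finite A Y], s + k = e →
      IsSyz A s Y → (∀ i, 1 ≤ i → i ≤ k + e + 1 → ExtZero A i Y A) → P Y →
      Module.Free A Y := by
  induction k with
  | zero =>
    rintro s Y _ _ _ rfl hY hext hPY
    exact hbase Y hPY hY fun i hi hi' => hext i hi (by omega)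
  | succ k ih =>
    intro s Y _ _ _ hs hY hext hPY
    obtain ⟨n, g, hg, -⟩ := exists_minimal_cover (A := A) Y
    have hK : Module.Free A (LinearMap.ker g) := ih (s + 1) (LinearMap.ker g) (by omega)
      ⟨_, _, _, _, _, _, (LinearMap.ker g).subtype, g, inferInstance, inferInstance,
        Subtype.val_injective, exact_ker_subtype g, hg, hY⟩
      (fun i hi hi' => ExtZero.syzygy _ g Subtype.val_injective (exact_ker_subtype g) hg
        (by omega) (hext (i + 1) (by omega) (by omega)))
      (hP Y _ g hg hPY fun i hi hi' => hext i hi (by omega))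
    exact free_of_free_syzygy _ g Subtype.val_injective (exact_ker_subtype g) hg
      (hext 1 le_rfl (by omega))

/-- A module of finite projective dimension with enough Ext vanishing into the ring is free. -/
lemma free_of_ext_bounded {l : List A} (hl : RegSocle (maximalIdeal A) l A)
    (Y : Type) [AddCommGroup Y] [Module A Y] [Module.Finite A Y]
    (hext : ∀ i, 1 ≤ i → i ≤ 2 * l.length + 1 → ExtZero A i Y A)
    (hY : ∃ q, ∀ (X : Type) [AddCommGroup X] [Module A X], ∀ i, q < i → ExtZero A i Y X) :
    Module.Free A Y := by
  refine free_of_descent l.length (fun Y _ _ => ∃ q, ∀ (X : Type) [AddCommGroup X] [Module A X],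
    ∀ i, q < i → ExtZero A i Y X) ?_ ?_ l.length 0 Y (by simp) trivial
    (fun i hi hi' => hext i hi (by omega)) hY
  · rintro Y F _ _ _ _ _ _ g hg ⟨q, hq⟩ -
    exact ⟨q, fun X _ _ i hi => ExtZero.syzygy _ g Subtype.val_injective (exact_ker_subtype g) hg
      (by omega) (hq X (i + 1) (by omega))⟩
  · rintro Y _ _ _ ⟨q, hq⟩ hY hext
    clear hext
    induction q generalizing Y with
    | zero =>
      obtain ⟨n, g, hg, -⟩ := exists_minimal_cover (A := A) Y
      obtain ⟨s, hs⟩ := ExtZero.exists_lift Subtype.val_injective (exact_ker_subtype g) hg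
        (hq _ 1 one_pos) LinearMap.id
      have : Module.Projective A Y := Module.Projective.of_split s g hs
      exact Module.free_of_flat_of_isLocalRing
    | succ q ih =>
      obtain ⟨n, g, hg, hm⟩ := exists_minimal_cover (A := A) Y
      have : Module.Free A (LinearMap.ker g) := ih (LinearMap.ker g)
        (fun X _ _ i hi => ExtZero.syzygy _ g Subtype.val_injective (exact_ker_subtype g) hg
          (by omega) (hq X (i + 1) (by omega)))
        (IsSyz.of_succ ⟨_, _, _, _, _, _, (LinearMap.ker g).subtype, g, inferInstance,
          inferInstance, Subtype.val_injective, exact_ker_subtype g, hg, hY⟩)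
      exact free_of_subsingleton_ker hg (subsingleton_of_free_syzygy _ g Subtype.val_injective
        (exact_ker_subtype g) hg (by simpa using hm) hl hY)

omit [IsNoetherianRing A] in
/-- The hypotheses of `free_of_ext_self` pass to syzygies. -/
lemma syzygy_ext_self {e : ℕ} (he : 2 ≤ e) {Y F : Type} [AddCommGroup Y] [AddCommGroup F]
    [Module A Y] [Module A F] [Module.Free A F] [Module.Finite A F] (g : F →ₗ[A] Y)
    (hg : Function.Surjective g) (hY : ExtZero A (e - 1) Y Y ∧
      ∀ z ∈ maximalIdeal A, ∃ c : ℕ, z ^ c ∈ freeFactorIdeal A Y) (hext : ExtZero A e Y A) :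
    ExtZero A (e - 1) (LinearMap.ker g) (LinearMap.ker g) ∧
      ∀ z ∈ maximalIdeal A, ∃ c : ℕ, z ^ c ∈ freeFactorIdeal A (LinearMap.ker g) := by
  refine ⟨ExtZero.syzygy_self _ g Subtype.val_injective (exact_ker_subtype g) hg (by omega)
    hY.1 ?_, fun z hz => ?_⟩
  · rwa [Nat.sub_add_cancel (by omega)]
  · obtain ⟨c, hc⟩ := hY.2 z hz
    exact ⟨c, freeFactorIdeal_le_of_exact _ g Subtype.val_injective (exact_ker_subtype g) hg hc⟩

lemma free_of_isSyz_of_ext_self {l : List A} {x y : A}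
    (hl : RegSocle (maximalIdeal A) (l ++ [x, y]) A)
    (hlm : ∀ z ∈ l ++ [x, y], z ∈ maximalIdeal A)
    (Y : Type) [AddCommGroup Y] [Module A Y] [Module.Finite A Y]
    (hY : IsSyz A (l.length + 2) Y)
    (hext : ∀ i, 1 ≤ i → i ≤ l.length + 3 → ExtZero A i Y A)
    (hPY : ExtZero A (l.length + 2 - 1) Y Y ∧
      ∀ z ∈ maximalIdeal A, ∃ c : ℕ, z ^ c ∈ freeFactorIdeal A Y) :
    Module.Free A Y := by
  obtain ⟨n, g, hg, hm⟩ := exists_minimal_cover (A := A) Y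
  obtain ⟨n', g', hg', hm'⟩ := exists_minimal_cover (A := A) (LinearMap.ker g)
  have hL := syzygy_ext_self (by omega) g hg hPY (hext _ (by omega) (by omega))
  have hN := syzygy_ext_self (by omega) g' hg' hL (ExtZero.syzygy _ g Subtype.val_injective
    (exact_ker_subtype g) hg (by omega) (hext _ (by omega) le_rfl))
  have h1 := (Submodule.range_subtype (LinearMap.ker g)).trans_le hm
  have h2 := (Submodule.range_subtype (LinearMap.ker g')).trans_le hm'
  exact free_of_subsingleton_ker hg (subsingleton_of_ext_syzygy _ g Subtype.val_injective
    (exact_ker_subtype g) hg h1 _ g' Subtype.val_injective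
    (exact_ker_subtype g') hg' h2 hl hY (fun z hz => hN.2 z (hlm z hz)) hN.1)

/-- A module which is free on the punctured spectrum is free if it has enough Ext vanishing into
the ring and no self-extension in degree one less than the depth of the ring. -/
lemma free_of_ext_self {l : List A} (hl : RegSocle (maximalIdeal A) l A) (hl2 : 2 ≤ l.length)
    (hlm : ∀ z ∈ l, z ∈ maximalIdeal A)
    (Y : Type) [AddCommGroup Y] [Module A Y] [Module.Finite A Y]
    (hext : ∀ i, 1 ≤ i → i ≤ 2 * l.length + 1 → ExtZero A i Y A)
    (hself : ExtZero A (l.length - 1) Y Y)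
    (hY : ∀ z ∈ maximalIdeal A, ∃ c : ℕ, z ^ c ∈ freeFactorIdeal A Y) :
    Module.Free A Y := by
  obtain ⟨l, x, y, rfl⟩ : ∃ l' x y, l = l' ++ [x, y] := by
    rcases List.eq_nil_or_concat' l with rfl | ⟨l₁, y, rfl⟩
    · simp at hl2
    rcases List.eq_nil_or_concat' l₁ with rfl | ⟨l₂, x, rfl⟩
    · simp at hl2
    exact ⟨l₂, x, y, by simp⟩
  obtain ⟨e, he⟩ : ∃ e, e = l.length + 2 := ⟨_, rfl⟩
  have hlen : (l ++ [x, y]).length = e := by simp [he]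
  rw [hlen] at hext hself hl2
  refine free_of_descent e (fun Y _ _ => ExtZero A (e - 1) Y Y ∧
    ∀ z ∈ maximalIdeal A, ∃ c : ℕ, z ^ c ∈ freeFactorIdeal A Y)
    (fun Y F _ _ _ _ _ _ g hg hY hext => syzygy_ext_self hl2 g hg hY (hext e (by omega) (by omega)))
    (fun Y _ _ _ hPY hY hext => ?_) e 0 Y (by simp)
    trivial (fun i hi hi' => hext i hi (by omega)) ⟨hself, hY⟩
  subst he
  exact free_of_isSyz_of_ext_self hl hlm Y hY (fun i hi hi' => hext i hi (by omega)) hPY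

end localRing

section localization

variable {R : Type} [CommRing R] (S : Submonoid R)

lemma LocalizedModule.map_exact_of_exact {X Y Z : Type} [AddCommGroup X] [AddCommGroup Y]
    [AddCommGroup Z] [Module R X] [Module R Y] [Module R Z] {f : X →ₗ[R] Y} {g : Y →ₗ[R] Z}
    (h : Function.Exact f g) :
    Function.Exact (LocalizedModule.map S f) (LocalizedModule.map S g) :=
  IsLocalizedModule.map_exact S (LocalizedModule.mkLinearMap S X) (LocalizedModule.mkLinearMap S Y)
    (LocalizedModule.mkLinearMap S Z) f g h

lemma LocalizedModule.exists_lift_map {M N : Type} [AddCommGroup M] [AddCommGroup N] [Module R M]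
    [Module R N] [Module.FinitePresentation R M]
    (φ : LocalizedModule S M →ₗ[Localization S] LocalizedModule S N) :
    ∃ (h : M →ₗ[R] N) (s : S), LocalizedModule.map S h = (s : R) • φ := by
  obtain ⟨h, s, hs⟩ := Module.FinitePresentation.exists_lift_of_isLocalizedModule S
    (LocalizedModule.mkLinearMap S N) (φ.restrictScalars R ∘ₗ LocalizedModule.mkLinearMap S M)
  refine ⟨h, s, LinearMap.restrictScalars_injective R ?_⟩
  refine IsLocalizedModule.linearMap_ext S (LocalizedModule.mkLinearMap S M)
    (LocalizedModule.mkLinearMap S N) ?_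
  ext n
  have := LinearMap.congr_fun hs n
  simpa [Submonoid.smul_def] using this

instance LocalizedModule.free_localization (F : Type) [AddCommGroup F] [Module R F]
    [Module.Free R F] : Module.Free (Localization S) (LocalizedModule S F) :=
  Module.Free.of_equiv (LocalizedModule.equivTensorProduct S F).symm

instance LocalizedModule.finite_localization (F : Type) [AddCommGroup F] [Module R F]
    [Module.Finite R F] : Module.Finite (Localization S) (LocalizedModule S F) :=
  Module.Finite.equiv (LocalizedModule.equivTensorProduct S F).symm

variable [IsNoetherianRing R] {M X : Type} [AddCommGroup X] [Module R X]

lemma ExtZero.localize {i : ℕ} : ∀ {M : Type} [AddCommGroup M] [Module R M] [Module.Finite R M],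
    ExtZero R (i + 1) M X →
    ExtZero (Localization S) (i + 1) (LocalizedModule S M) (LocalizedModule S X) := by
  induction i with
  | zero =>
    intro M _ _ _ hM
    obtain ⟨n, g, hg⟩ := Module.Finite.exists_fin' R M
    have hinj : Function.Injective (LinearMap.ker g).subtype := Subtype.val_injective
    have hex := exact_ker_subtype g
    refine ExtZero.one_of_extend (LocalizedModule.map_injective S _ hinj)
      (LocalizedModule.map_exact_of_exact S hex) (LocalizedModule.map_surjective S _ hg)
      (ExtZero.of_projective 1 one_ne_zero) fun φ => ?_
    have : Module.FinitePresentation R (LinearMap.ker g) :=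
      Module.finitePresentation_of_finite R _
    obtain ⟨h, s, hs⟩ := LocalizedModule.exists_lift_map S φ
    obtain ⟨H, rfl⟩ := ExtZero.exists_extend hinj hex hg hM h
    refine ⟨Localization.mk 1 s • LocalizedModule.map S H, ?_⟩
    have h1 : LocalizedModule.map S H ∘ₗ LocalizedModule.map S (LinearMap.ker g).subtype =
        (s : R) • φ := by
      rw [← hs]
      ext v
      induction v with | _ v t
      simp
    rw [LinearMap.smul_comp, h1, ← algebraMap_smul (Localization S) (s : R) φ, smul_smul,
      ← Localization.mk_one_eq_algebraMap, Localization.mk_mul, one_mul, mul_one,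
      Localization.mk_self, one_smul]
  | succ i ih =>
    intro M _ _ _ hM
    obtain ⟨n, g, hg⟩ := Module.Finite.exists_fin' R M
    have hinj : Function.Injective (LinearMap.ker g).subtype := Subtype.val_injective
    have hex := exact_ker_subtype g
    exact ExtZero.contravariant_right (LocalizedModule.map_injective S _ hinj)
      (LocalizedModule.map_exact_of_exact S hex) (LocalizedModule.map_surjective S _ hg)
      (ih (ExtZero.syzygy _ g hinj hex hg (by omega) hM))
      (ExtZero.of_projective _ (by omega))

lemma ExtZero.localize_ring {i : ℕ} [AddCommGroup M] [Module R M] [Module.Finite R M]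
    (h : ExtZero R (i + 1) M R) :
    ExtZero (Localization S) (i + 1) (LocalizedModule S M) (Localization S) :=
  (h.localize S).congr_right ((LocalizedModule.equivTensorProduct S R).trans
    (TensorProduct.AlgebraTensorModule.rid R (Localization S) (Localization S)))

omit [IsNoetherianRing R] in
lemma freeFactorIdeal_localize [AddCommGroup M] [Module R M] {a : R}
    (h : a ∈ freeFactorIdeal R M) :
    algebraMap R (Localization S) a ∈ freeFactorIdeal (Localization S) (LocalizedModule S M) := by
  obtain ⟨k, u, m, hu⟩ := mem_freeFactorIdeal_iff.mp h
  refine mem_freeFactorIdeal_iff.mpr ⟨k, fun j =>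
    ((LocalizedModule.equivTensorProduct S R).trans
      (TensorProduct.AlgebraTensorModule.rid R (Localization S) (Localization S))).toLinearMap ∘ₗ
      LocalizedModule.map S (u j), fun j => LocalizedModule.mk (m j) 1, fun n => ?_⟩
  induction n with | _ n t
  have h1 (r : R) : r • Localization.mk (1 : R) t = Localization.mk r t := by
    rw [Localization.smul_mk, smul_eq_mul, mul_one]
  simp only [LinearMap.coe_comp, LinearEquiv.coe_coe, Function.comp_apply,
    LocalizedModule.map_mk, LinearEquiv.trans_apply, LocalizedModule.equivTensorProduct_apply_mk,
    TensorProduct.AlgebraTensorModule.rid_tmul, h1, LocalizedModule.mk_smul_mk, mul_one,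
    algebraMap_smul, LocalizedModule.smul'_mk, hu]
  have h2 (v : M) : LocalizedModule.mk v t =
      Localization.mk 1 t • LocalizedModule.mkLinearMap S M v := by
    simp [LocalizedModule.mk_smul_mk]
  simp only [h2, map_sum, Finset.smul_sum]

lemma exists_mem_freeFactorIdeal [Nontrivial (Localization S)] [AddCommGroup M] [Module R M]
    [Module.Finite R M] (h : Module.Free (Localization S) (LocalizedModule S M)) :
    ∃ s ∈ S, s ∈ freeFactorIdeal R M := by
  let n := Module.finrank (Localization S) (LocalizedModule S M)
  let e : LocalizedModule S M ≃ₗ[Localization S] LocalizedModule S (Fin n → R) :=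
    (Module.finBasis (Localization S) (LocalizedModule S M)).equivFun.trans
      ((LocalizedModule.equivTensorProduct S (Fin n → R)).trans
        (TensorProduct.piScalarRight R (Localization S) (Localization S) (Fin n))).symm
  have : Module.FinitePresentation R M := Module.finitePresentation_of_finite R _
  obtain ⟨f, s, hs⟩ := LocalizedModule.exists_lift_map S e.toLinearMap
  obtain ⟨g, t, ht⟩ := LocalizedModule.exists_lift_map S e.symm.toLinearMap
  obtain ⟨w, hw⟩ := Module.Finite.exists_smul_of_comp_eq_of_isLocalizedModule S
    (LocalizedModule.mkLinearMap S M) (g ∘ₗ f) (((t * s : S) : R) • LinearMap.id) (by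
      ext v
      have h1 := LinearMap.congr_fun ht (LocalizedModule.map S f (LocalizedModule.mk v 1))
      rw [hs] at h1
      have h2 := LinearMap.congr_fun hs (LocalizedModule.mk v 1)
      simp only [LinearMap.smul_apply, LocalizedModule.map_mk, LinearEquiv.coe_coe] at h1 h2
      rw [← h2] at h1
      simp only [LocalizedModule.map_mk] at h1
      rw [h2, ← algebraMap_smul (Localization S) (s : R) (e _), map_smul,
        LinearEquiv.symm_apply_apply, algebraMap_smul, ← mul_smul] at h1
      simpa using h1)
  refine ⟨w * (t * s), S.mul_mem w.2 (t * s).2, mem_freeFactorIdeal_iff.mpr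
    ⟨n, fun j => LinearMap.proj j ∘ₗ f, fun j => w • g (Pi.single j 1), fun v => ?_⟩⟩
  have h1 := LinearMap.congr_fun hw v
  simp only [LinearMap.smul_apply, LinearMap.comp_apply, LinearMap.id_apply] at h1
  rw [mul_smul]
  refine h1.symm.trans ?_
  conv_lhs => rw [pi_eq_sum_univ' (f v)]
  simp [Finset.smul_sum, smul_comm w]

omit [IsNoetherianRing R] in
lemma projective_of_freeFactorIdeal_eq_top [AddCommGroup M] [Module R M]
    (h : freeFactorIdeal R M = ⊤) : Module.Projective R M := by
  obtain ⟨k, u, m, hu⟩ := mem_freeFactorIdeal_iff.mp ((Ideal.eq_top_iff_one _).mp h)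
  refine Module.Projective.of_split (LinearMap.pi u) (Fintype.linearCombination R m) ?_
  ext n
  simp [Fintype.linearCombination_apply, ← hu]

end localization

section depth

variable {R : Type} [CommRing R]

/-- The projection to the quotient by the multiples of a ring element. -/
def quotSMulTopMk (x : R) (N : Type) [AddCommGroup N] [Module R N] : N →ₗ[R] QuotSMulTop x N :=
  Submodule.mkQ _

lemma exact_quotSMulTopMk {N : Type} [AddCommGroup N] [Module R N] (x : R) :
    Function.Exact (LinearMap.lsmul R N x) (quotSMulTopMk x N) := by
  intro n
  refine (Submodule.Quotient.mk_eq_zero _).trans ?_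
  simp [Submodule.mem_smul_pointwise_iff_exists]

/-- Vanishing of `Ext` from `k` in degrees less than `t + 1` passes to the quotient by a regular
element, in degrees less than `t`. -/
lemma extZero_quotSMulTop {k N : Type} [AddCommGroup k] [Module R k] [AddCommGroup N]
    [Module R N] {t : ℕ} (h : ∀ i < t + 1, ExtZero R i k N) {x : R} (hx : IsSMulRegular N x) :
    ∀ i < t, ExtZero R i k (QuotSMulTop x N) := fun i hi =>
  ExtZero.covariant_right (f := LinearMap.lsmul R N x) hx (exact_quotSMulTopMk x)
    (Submodule.mkQ_surjective _) (h i (by omega)) (h (i + 1) (by omega))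

variable [IsNoetherianRing R]

lemma exists_prime_annihilating {N : Type} [AddCommGroup N] [Module R N] {n : N} (hn : n ≠ 0) :
    ∃ (q : PrimeSpectrum R) (y : N), y ≠ 0 ∧ (∀ z, z ∈ q.asIdeal ↔ z • y = 0) ∧
      ∀ z : R, z • n = 0 → z ∈ q.asIdeal := by
  obtain ⟨P, hP, hnP⟩ := exists_le_isAssociatedPrime_of_isNoetherianRing R n hn
  obtain ⟨hp, y, rfl⟩ := isAssociatedPrime_iff.mp hP
  refine ⟨⟨_, hp⟩, y, ?_, fun z => ?_, fun z hz => hnP ?_⟩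
  · rintro rfl
    exact hp.ne_top (by simp)
  · simp [Submodule.mem_colon_singleton]
  · simpa [Submodule.mem_colon_singleton] using hz

lemma exists_mem_isSMulRegular {N : Type} [AddCommGroup N] [Module R N] [Module.Finite R N]
    (I : Ideal R) (h : ∀ (q : PrimeSpectrum R) (n : N), n ≠ 0 → (∀ z ∈ q.asIdeal, z • n = 0) →
      ¬ I ≤ q.asIdeal) : ∃ x ∈ I, IsSMulRegular N x := by
  by_contra! hI
  obtain ⟨P, hP, hIP⟩ := (I.subset_union_prime_finite (associatedPrimes.finite R N) (f := id) 0 0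
    fun _ h _ _ => h.isPrime).1 <| by
      simp_rw [id, biUnion_associatedPrimes_eq_compl_regular]
      exact fun x hx => hI x hx
  obtain ⟨hp, y, rfl⟩ := isAssociatedPrime_iff.mp hP
  refine h ⟨_, hp⟩ y ?_ (fun z hz => ?_) hIP
  · rintro rfl
    exact hp.ne_top (by simp)
  · simpa [Submodule.mem_colon_singleton] using hz

variable [IsLocalRing R]

lemma le_coheight_of_extZero (t : ℕ) : ∀ {N : Type} [AddCommGroup N] [Module R N]
    [Module.Finite R N], (∀ i < t, ExtZero R i (R ⧸ maximalIdeal R) N) →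
    ∀ (p : PrimeSpectrum R) (n : N), n ≠ 0 → (∀ z ∈ p.asIdeal, z • n = 0) →
      (t : ℕ∞) ≤ Order.coheight p := by
  induction t with
  | zero => simp
  | succ t ih =>
    intro N _ _ _ hN p n hn hpn
    obtain ⟨x, hxm, hx⟩ : ∃ x ∈ maximalIdeal R, IsSMulRegular N x := by
      refine exists_mem_isSMulRegular _ fun q y hy hq hle => hy ?_
      have := ExtZero.zero_iff.mp (hN 0 (by omega))
      let φ : (R ⧸ maximalIdeal R) →ₗ[R] N := Submodule.liftQ _ (LinearMap.toSpanSingleton R N y)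
        (fun z hz => by simpa using hq z (hle hz))
      have h0 : φ (Submodule.Quotient.mk 1) = y :=
        (Submodule.liftQ_apply _ _ (1 : R)).trans (by simp)
      rw [← h0, Subsingleton.elim φ 0, LinearMap.zero_apply]
    let N' : Submodule R N :=
      { carrier := {y | ∀ z ∈ p.asIdeal, z • y = 0}
        add_mem' := fun ha hb z hz => by rw [smul_add, ha z hz, hb z hz, add_zero]
        zero_mem' := fun z _ => smul_zero z
        smul_mem' := fun r y hy z hz => by rw [smul_comm, hy z hz, smul_zero] }
    obtain ⟨y, hy, hyx⟩ : ∃ y ∈ N', ∀ y' ∈ N', x • y' ≠ y := by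
      by_contra! hall
      have : N' = ⊥ := Submodule.eq_bot_of_le_smul_of_le_jacobson_bot (maximalIdeal R) N'
        (IsNoetherian.noetherian N') (fun y hy => by
          obtain ⟨y', hy', rfl⟩ := hall y hy
          exact Submodule.smul_mem_smul hxm hy') (maximalIdeal_le_jacobson _)
      exact hn ((Submodule.mem_bot R).mp (this ▸ (show n ∈ N' from hpn)))
    have hc : quotSMulTopMk x N y ≠ 0 := fun hc => by
      obtain ⟨y', hy'⟩ := (exact_quotSMulTopMk x y).mp hc
      refine hyx y' (fun z hz => hx.right_eq_zero_of_smul ?_) hy'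
      rw [smul_comm]
      exact (congrArg (z • ·) hy').trans (hy z hz)
    have hxc : x • quotSMulTopMk x N y = 0 :=
      (map_smul _ x y).symm.trans ((exact_quotSMulTopMk x _).mpr ⟨y, rfl⟩)
    obtain ⟨q, w, hw, hqw, hq⟩ := exists_prime_annihilating (R := R) hc
    have hpq : p < q := by
      refine lt_of_le_of_ne (fun z hz => hq z ?_) ?_
      · exact (map_smul _ z y).symm.trans (by rw [hy z hz, map_zero])
      · rintro rfl
        exact hn (hx.right_eq_zero_of_smul (hpn x (hq x hxc)))
    have := ih (extZero_quotSMulTop hN hx) q w hw fun z hz => (hqw z).mp hz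
    push_cast
    exact (by gcongr : (t : ℕ∞) + 1 ≤ Order.coheight q + 1).trans (Order.coheight_add_one_le hpq)

/-- A prime all of whose overprimes have small coheight contains a long regular sequence. -/
lemma exists_isWeaklyRegular (p : PrimeSpectrum R) {c : ℕ} (hc : Order.coheight p ≤ c) (e : ℕ) :
    ∀ {N : Type} [AddCommGroup N] [Module R N] [Module.Finite R N],
    (∀ i < c + e, ExtZero R i (R ⧸ maximalIdeal R) N) →
    ∃ l : List R, l.length = e ∧ (∀ z ∈ l, z ∈ p.asIdeal) ∧
      RingTheory.Sequence.IsWeaklyRegular N l := by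
  induction e with
  | zero => exact fun _ => ⟨[], rfl, by simp, by simp⟩
  | succ e ih =>
    intro N _ _ _ hN
    obtain ⟨x, hxp, hx⟩ : ∃ x ∈ p.asIdeal, IsSMulRegular N x := by
      refine exists_mem_isSMulRegular _ fun q n hn hq hle => ?_
      have h1 := (le_coheight_of_extZero _ hN q n hn hq).trans
        ((Order.coheight_anti (show p ≤ q from hle)).trans hc)
      norm_cast at h1
      omega
    obtain ⟨l, hl, hlp, hreg⟩ := ih (extZero_quotSMulTop hN hx)
    refine ⟨x :: l, by simp [hl], ?_, (RingTheory.Sequence.isWeaklyRegular_cons_iff N x l).mpr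
      ⟨hx, hreg⟩⟩
    simpa [hxp] using hlp

lemma RegSocle.of_isWeaklyRegular {l : List R} : ∀ {N : Type} [AddCommGroup N] [Module R N]
    [Module.Finite R N], (∀ z ∈ l, z ∈ maximalIdeal R) →
    RingTheory.Sequence.IsWeaklyRegular N l → Module.supportDim R N = l.length →
    RegSocle (maximalIdeal R) l N := by
  induction l with
  | nil =>
    intro N _ _ _ _ _ hdim
    have hne : Nontrivial N := by
      rw [← Module.supportDim_ne_bot_iff_nontrivial R, hdim]; simp
    obtain ⟨n, hn⟩ := exists_ne (0 : N)
    obtain ⟨q, y, hy, hq, -⟩ := exists_prime_annihilating (R := R) hn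
    refine ⟨y, hy, fun z hz => (hq z).mp ?_⟩
    have hqs : q ∈ Module.support R N := by
      rw [Module.mem_support_iff_exists_annihilator]
      exact ⟨y, fun z hz => (hq z).mpr ((Submodule.mem_annihilator_span_singleton y z).mp hz)⟩
    rw [support_of_supportDim_eq_zero R N (by simpa using hdim)] at hqs
    exact hqs hz
  | cons x l ih =>
    intro N _ _ _ hl hreg hdim
    rw [RingTheory.Sequence.isWeaklyRegular_cons_iff] at hreg
    refine ⟨hreg.1, ih (fun z hz => hl z (by simp [hz])) hreg.2 ?_⟩
    have := Module.supportDim_quotSMulTop_succ_eq_supportDim hreg.1 (hl x (by simp))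
    rw [hdim, List.length_cons, Nat.cast_add, Nat.cast_one] at this
    exact ENat.WithBot.add_one_cancel.mp this

end depth

lemma extZero_of_hasPdLE {A : Type} [CommRing A] (k : ℕ) : ∀ (Y : Type) [AddCommGroup Y]
    [Module A Y], hasPdLE A k Y →
    ∀ (X : Type) [AddCommGroup X] [Module A X], ∀ i, k < i → ExtZero A i Y X := by
  induction k with
  | zero =>
    intro Y _ _ hY X _ _ i hi
    have : Module.Projective A Y := hY
    exact ExtZero.of_projective i hi.ne'
  | succ k ih =>
    rintro Y _ _ ⟨P, _, _, f, _, hf, hk⟩ X _ _ i hi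
    obtain ⟨i, rfl⟩ := Nat.exists_eq_add_of_lt (Nat.zero_lt_of_lt hi)
    rw [zero_add]
    exact ExtZero.contravariant_right Subtype.val_injective (exact_ker_subtype f) hf
      (ih _ hk X i (by omega)) (ExtZero.of_projective _ (by omega))

section CohenMacaulay

variable {R : Type} [CommRing R] [IsLocalRing R]

lemma IsCMLocal.extZero (hCM : IsCMLocal R) {d : ℕ} (hd : ringKrullDim R = d) :
    ∀ i < d, ExtZero R i (R ⧸ maximalIdeal R) R := by
  intro i hi
  refine ExtZero.of_extGroup (not_nontrivial_iff_subsingleton.mp fun h => ?_)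
  have hle : moduleDepth R R ≤ (i : ℕ∞) := sInf_le ⟨i, rfl, h⟩
  have heq : moduleDepth R R = (d : ℕ∞) := by
    have := hCM.trans hd
    exact_mod_cast this
  rw [heq] at hle
  norm_cast at hle
  omega

/-- The localization of a Cohen–Macaulay local ring at a prime of height `e` has a regular
sequence of length `e` with a nonzero socle modulo that sequence. -/
lemma IsCMLocal.exists_regSocle [IsNoetherianRing R] (hCM : IsCMLocal R) {d : ℕ}
    (hd : ringKrullDim R = d) (p : PrimeSpectrum R) :
    ∃ l : List (Localization.AtPrime p.asIdeal), l.length ≤ d ∧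
      ringKrullDim (Localization.AtPrime p.asIdeal) = l.length ∧
      (∀ z ∈ l, z ∈ maximalIdeal (Localization.AtPrime p.asIdeal)) ∧
      RegSocle (maximalIdeal (Localization.AtPrime p.asIdeal)) l
        (Localization.AtPrime p.asIdeal) := by
  have hsum : Order.height p + Order.coheight p ≤ d := by
    have h := Order.krullDim_eq_iSup_height_add_coheight_of_nonempty (α := PrimeSpectrum R)
    rw [show Order.krullDim (PrimeSpectrum R) = ringKrullDim R from rfl, hd] at h
    have h' : (d : ℕ∞) = ⨆ a : PrimeSpectrum R, Order.height a + Order.coheight a := by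
      exact_mod_cast h
    exact h' ▸ le_iSup (fun a : PrimeSpectrum R => Order.height a + Order.coheight a) p
  obtain ⟨e, he⟩ := ENat.ne_top_iff_exists.mp
    (ne_top_of_le_ne_top (ENat.natCast_ne_top d) (le_self_add.trans hsum))
  obtain ⟨c, hc⟩ := ENat.ne_top_iff_exists.mp
    (ne_top_of_le_ne_top (ENat.natCast_ne_top d) (le_add_self.trans hsum))
  rw [← he, ← hc] at hsum
  norm_cast at hsum
  obtain ⟨l, hl, hlp, hreg⟩ := exists_isWeaklyRegular p hc.ge e (N := R)
    fun i hi => hCM.extZero hd i (by omega)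
  have hdim : ringKrullDim (Localization.AtPrime p.asIdeal) = e := by
    rw [IsLocalization.AtPrime.ringKrullDim_eq_height p.asIdeal,
      PrimeSpectrum.height_eq_orderHeight, ← he]
    rfl
  have hmem : ∀ z ∈ l.map (algebraMap R (Localization.AtPrime p.asIdeal)),
      z ∈ maximalIdeal (Localization.AtPrime p.asIdeal) := by
    intro z hz
    obtain ⟨r, hr, rfl⟩ := List.mem_map.mp hz
    exact (IsLocalization.AtPrime.to_map_mem_maximal_iff _ p.asIdeal r).mpr (hlp r hr)
  refine ⟨l.map (algebraMap R (Localization.AtPrime p.asIdeal)), by simp; omega,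
    by simpa [hl] using hdim, hmem, RegSocle.of_isWeaklyRegular hmem
      (RingTheory.Sequence.IsWeaklyRegular.of_isLocalization _ p.asIdeal.primeCompl hreg) ?_⟩
  rw [Module.supportDim_self_eq_ringKrullDim, hdim, List.length_map, hl]

end CohenMacaulay

lemma exists_pow_mem_freeFactorIdeal_localization {R : Type} [CommRing R] {M : Type}
    [AddCommGroup M] [Module R M] (p : Ideal R) [p.IsPrime]
    (hp : p ∈ (freeFactorIdeal R M).minimalPrimes) (z : Localization.AtPrime p)
    (hz : z ∈ maximalIdeal (Localization.AtPrime p)) :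
    ∃ c : ℕ, z ^ c ∈ freeFactorIdeal (Localization.AtPrime p)
      (LocalizedModule p.primeCompl M) := by
  rw [← Localization.AtPrime.map_eq_maximalIdeal,
    ← IsLocalization.AtPrime.radical_map_of_mem_minimalPrimes _ p _ hp] at hz
  obtain ⟨c, hc⟩ := hz
  have hle : (freeFactorIdeal R M).map (algebraMap R (Localization.AtPrime p)) ≤
      freeFactorIdeal (Localization.AtPrime p) (LocalizedModule p.primeCompl M) :=
    Ideal.map_le_iff_le_comap.mpr fun a ha =>
      freeFactorIdeal_localize (M := M) p.primeCompl ha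
  exact ⟨c, hle hc⟩

/-- If `Ext^i(M, R) = 0` for `1 ≤ i ≤ 2d+1` and `Ext^j(M, M) = 0` for `n ≤ j ≤ d−1`, and
`M` is locally of finite projective dimension in codimension `n`, then `M` is free. -/
theorem free_of_ext_self_and_ring_vanishing (R : Type) [CommRing R] [IsNoetherianRing R]
    [IsLocalRing R] (d n : ℕ) (hd : ringKrullDim R = d) (hd2 : 2 ≤ d)
    (hn1 : 1 ≤ n) (hn2 : n ≤ d - 1) (hCM : IsCMLocal R)
    (M : Type) [AddCommGroup M] [Module R M] [Module.Finite R M]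
    (hMp : ∀ p : PrimeSpectrum R, ringKrullDim (Localization.AtPrime p.asIdeal) ≤ (n : WithBot ℕ∞) →
      ∃ k : ℕ, hasPdLE (Localization.AtPrime p.asIdeal) k (LocalizedModule p.asIdeal.primeCompl M))
    (h1 : ∀ i : ℕ, 1 ≤ i → i ≤ 2 * d + 1 → Subsingleton (extGroup R i M R))
    (h2 : ∀ j : ℕ, n ≤ j → j ≤ d - 1 → Subsingleton (extGroup R j M M)) :
    Module.Free R M := by
  by_cases hI : freeFactorIdeal R M = ⊤
  · have := projective_of_freeFactorIdeal_eq_top hI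
    exact Module.free_of_flat_of_isLocalRing
  obtain ⟨p, hp⟩ := Ideal.nonempty_minimalPrimes hI
  have hpp : p.IsPrime := hp.1.1
  suffices hfree : Module.Free (Localization.AtPrime p) (LocalizedModule p.primeCompl M) by
    have : Nontrivial (Localization p.primeCompl) :=
      inferInstanceAs (Nontrivial (Localization.AtPrime p))
    obtain ⟨s, hs, hsI⟩ := exists_mem_freeFactorIdeal p.primeCompl (M := M) hfree
    exact absurd (hp.1.2 hsI) hs
  obtain ⟨l, hl, hdim, hlm, hreg⟩ := hCM.exists_regSocle hd ⟨p, hpp⟩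
  have hext : ∀ i, 1 ≤ i → i ≤ 2 * l.length + 1 →
      ExtZero (Localization.AtPrime p) i (LocalizedModule p.primeCompl M)
        (Localization.AtPrime p) := by
    intro i hi hi'
    obtain ⟨i, rfl⟩ := Nat.exists_eq_add_of_le' hi
    exact (ExtZero.of_extGroup (h1 _ hi (by omega))).localize_ring p.primeCompl
  rcases le_or_gt l.length n with hln | hln
  · obtain ⟨k, hk⟩ := hMp ⟨p, hpp⟩ (by rw [hdim]; exact_mod_cast hln)
    exact free_of_ext_bounded hreg _ hext ⟨k, extZero_of_hasPdLE k _ hk⟩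
  · refine free_of_ext_self hreg (by omega) hlm _ hext ?_
      (exists_pow_mem_freeFactorIdeal_localization p hp)
    obtain ⟨j, hj⟩ := Nat.exists_eq_add_of_le' (show 1 ≤ l.length - 1 by omega)
    rw [hj]
    exact (ExtZero.of_extGroup (h2 (j + 1) (by omega) (by omega))).localize p.primeCompl
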